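/- Let μ be a positive Borel measure on 𝕋^d with total mass 1 which is pluriharmonic and moreover singular with respect to Lebesgue measure on 𝕋^d. Then any holomorphic function φ_μ : 𝔻^d → 𝔻 satisfying (1−|φ_μ(z)|²)/|1−φ_μ(z)|² = ∫_{𝕋^d} P_z(ζ) dμ(ζ) for all z ∈ 𝔻^d is an inner function: |lim_{r→1⁻} φ_μ(rζ)| = 1 for Lebesgue-a.e. ζ ∈ 𝕋^d. -/

import Mathlib

open MeasureTheory Complex Filter Topology

noncomputable section

/-- The open unit polydisk `𝔻^d` in `ℂ^d`. -/
def polyDisk (d : ℕ) : Set (Fin d → ℂ) := {z | ∀ j, ‖z j‖ < 1}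

/-- The distinguished boundary `𝕋^d` of the polydisk. -/
def polyTorus (d : ℕ) : Set (Fin d → ℂ) := {z | ∀ j, ‖z j‖ = 1}

/-- The product Poisson kernel `P_z(ζ) = ∏_j (1-|z_j|²)/|ζ_j - z_j|²`. -/
def poissonD (d : ℕ) (z ζ : Fin d → ℂ) : ℝ :=
  ∏ j, (1 - ‖z j‖ ^ 2) / ‖ζ j - z j‖ ^ 2

/-- `φ` has radial limit `L` at `ζ`:  `φ(rζ) → L` as `r → 1⁻`. -/
def HasRadialLimit (d : ℕ) (φ : (Fin d → ℂ) → ℂ) (ζ : Fin d → ℂ) (L : ℂ) : Prop :=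
  Tendsto (fun r : ℝ => φ (fun j => (r : ℂ) * ζ j)) (𝓝[<] (1 : ℝ)) (𝓝 L)

/-- Normalized Lebesgue measure on the d-torus, as a measure on `ℂ^d`. -/
def torusLebesgue (d : ℕ) : Measure (Fin d → ℂ) :=
  (ENNReal.ofReal ((2 * Real.pi) ^ d))⁻¹ •
    Measure.map (fun θ : Fin d → ℝ => fun j => Complex.exp ((θ j : ℂ) * Complex.I))
      (MeasureTheory.volume.restrict (Set.pi Set.univ fun _ => Set.Ico 0 (2 * Real.pi)))

/-- `φ = q/p` is a rational inner function on `𝔻^d`: `p, q` have no common factor,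
`p` is zero-free on the polydisk, `φ` maps `𝔻^d` to `𝔻`, and the radial limits of `φ`
are unimodular a.e. on `𝕋^d`. -/
structure IsRIFd (d : ℕ) (p q : MvPolynomial (Fin d) ℂ) : Prop where
  coprime : ∀ r : MvPolynomial (Fin d) ℂ, r ∣ p → r ∣ q → IsUnit r
  stable : ∀ z ∈ polyDisk d, MvPolynomial.eval z p ≠ 0
  mapsToDisk : ∀ z ∈ polyDisk d,
    ‖MvPolynomial.eval z q / MvPolynomial.eval z p‖ < 1
  inner : ∀ᵐ ζ ∂(torusLebesgue d),
    ∃ L : ℂ, ‖L‖ = 1 ∧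
      HasRadialLimit d (fun z => MvPolynomial.eval z q / MvPolynomial.eval z p) ζ L

/-- `σ` is the Clark measure of `φ` at parameter `α`: a positive Borel measure on `𝕋^d`
whose Poisson integral is `(1-|φ(z)|²)/|α-φ(z)|²`. -/
def IsClarkMeasureD (d : ℕ) (φ : (Fin d → ℂ) → ℂ) (α : ℂ) (σ : Measure (Fin d → ℂ)) : Prop :=
  σ (polyTorus d)ᶜ = 0 ∧
  ∀ z ∈ polyDisk d,
    ∫⁻ ζ, ENNReal.ofReal (poissonD d z ζ) ∂σ =
      ENNReal.ofReal ((1 - ‖φ z‖ ^ 2) / ‖α - φ z‖ ^ 2)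

/-- The unimodular level set `C_α(φ)`. -/
def levelSetD (d : ℕ) (φ : (Fin d → ℂ) → ℂ) (α : ℂ) : Set (Fin d → ℂ) :=
  closure {ζ | ζ ∈ polyTorus d ∧ HasRadialLimit d φ ζ α}

/-- The topological support of a measure: points all of whose open neighborhoods
have positive measure. -/
def measureSupport {X : Type*} [TopologicalSpace X] [MeasurableSpace X]
    (μ : Measure X) : Set X :=
  {x | ∀ U : Set X, IsOpen U → x ∈ U → 0 < μ U}


lemma fz_poisson_int {z : ℂ} (hz : ‖z‖ < 1) :
    ∫ t in (0:ℝ)..(2 * Real.pi), (1 - ‖z‖ ^ 2) / ‖circleMap 0 1 t - z‖ ^ 2 = 2 * Real.pi := by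
  have h := DiffContOnCl.circleAverage_poissonKernel_smul' (E := ℂ) (f := fun _ => (1:ℂ)) (R := 1) (c := 0) (w := z)
    diffContOnCl_const (by simpa using hz)
  rw [Real.circleAverage_def] at h
  have h2 : (fun t : ℝ => ((‖circleMap 0 1 t - 0‖ ^ 2 - ‖z - 0‖ ^ 2) /
      ‖(circleMap 0 1 t - 0) - (z - 0)‖ ^ 2) • (1:ℂ)) =
      fun t => (((1 - ‖z‖ ^ 2) / ‖circleMap 0 1 t - z‖ ^ 2 : ℝ) : ℂ) := by
    funext t
    simp [circleMap]
  rw [h2, intervalIntegral.integral_ofReal] at h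
  rw [Complex.real_smul, ← Complex.ofReal_mul] at h
  have h3 := Complex.ofReal_injective (h.trans Complex.ofReal_one.symm)
  have hpi := Real.pi_pos
  field_simp at h3
  linarith

lemma fz_cauchy_deriv {g : ℂ → ℂ} (hg : DiffContOnCl ℂ g (Metric.ball 0 1)) {z : ℂ} (hz : ‖z‖ < 1) :
    (∮ w in C(0, 1), g w * (1 / (w - z) ^ 2)) = (2 * Real.pi * I : ℂ) * deriv g z := by
  have hzb : z ∈ Metric.ball (0:ℂ) 1 := by simpa using hz
  have hds : DiffContOnCl ℂ (dslope g z) (Metric.ball 0 1) := by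
    constructor
    · exact (Complex.differentiableOn_dslope (Metric.isOpen_ball.mem_nhds hzb)).2 hg.1
    · intro w hw
      by_cases hwz : w = z
      · subst hwz
        exact (continuousAt_dslope_same.2 (hg.differentiableAt Metric.isOpen_ball hzb)).continuousWithinAt
      · exact (continuousWithinAt_dslope_of_ne hwz).2 (hg.2 w hw)
  have h1 := hds.circleIntegral_sub_inv_smul hzb
  rw [dslope_same, smul_eq_mul] at h1
  rw [← h1]
  have hne : ∀ w ∈ Metric.sphere (0:ℂ) 1, w - z ≠ 0 := by
    intro w hw h
    rw [sub_eq_zero] at h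
    subst h
    simp at hw; linarith
  have h0 : (∮ w in C(0, 1), g z * (1 / (w - z) ^ 2)) = 0 := by
    have := circleIntegral.integral_sub_zpow_of_ne (n := -2) (by norm_num) 0 z 1
    have h' : (∮ w in C(0, 1), (1 / (w - z) ^ 2)) = 0 := by
      rw [← this]
      congr 1
      funext w
      rw [zpow_neg, one_div]; rfl
    rw [circleIntegral.integral_const_mul, h', mul_zero]
  have hc2 : ContinuousOn (fun w : ℂ => 1 / (w - z) ^ 2) (Metric.sphere 0 1) := by
    apply ContinuousOn.div continuousOn_const (by fun_prop)
    intro w hw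
    exact pow_ne_zero _ (hne w hw)
  have hgc : ContinuousOn g (Metric.sphere 0 1) := by
    apply hg.continuousOn_ball.mono Metric.sphere_subset_closedBall
  refine (sub_eq_self.2 h0).symm.trans ?_
  rw [← circleIntegral.integral_sub]
  · apply circleIntegral.integral_congr (by norm_num)
    intro w hw
    have := hne w hw
    have hwz : w ≠ z := sub_ne_zero.1 this
    simp only [smul_eq_mul]
    rw [dslope_of_ne _ hwz, slope_def_field]
    field_simp
  · exact (hgc.mul hc2).circleIntegrable (by norm_num)
  · exact (continuousOn_const.mul hc2).circleIntegrable (by norm_num)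

lemma fz_cauchy_out {g : ℂ → ℂ} (hg : DiffContOnCl ℂ g (Metric.ball 0 1)) {z : ℂ} (hz : 1 < ‖z‖) :
    (∮ w in C(0, 1), g w * (1 / (w - z) ^ 2)) = 0 := by
  have hne : ∀ w ∈ Metric.closedBall (0:ℂ) 1, w - z ≠ 0 := by
    intro w hw h
    rw [sub_eq_zero] at h
    subst h
    simp at hw; linarith
  apply DiffContOnCl.circleIntegral_eq_zero (by norm_num)
  have : DiffContOnCl ℂ (fun w : ℂ => 1 / (w - z) ^ 2) (Metric.ball 0 1) := by
    constructor
    · intro w hw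
      have := hne w (Metric.ball_subset_closedBall hw)
      apply DifferentiableAt.differentiableWithinAt
      fun_prop (disch := exact pow_ne_zero _ this)
    · rw [closure_ball _ one_ne_zero]
      apply ContinuousOn.div continuousOn_const (by fun_prop)
      intro w hw
      exact pow_ne_zero _ (hne w hw)
  exact hg.smul this

lemma fz_two {w ζ : ℂ} (hw : ‖w‖ = 1) (hζ : ‖ζ‖ = 1) {r : ℝ} (h0 : 0 < r) (h1 : r < 1) :
    0 < ‖w - r * ζ‖ ∧ ‖w - ζ‖ ≤ 2 * ‖w - r * ζ‖ := by
  have hlow : 1 - r ≤ ‖w - r * ζ‖ := by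
    have := norm_sub_norm_le w (r * ζ)
    rw [norm_mul, hw, hζ, Complex.norm_real, Real.norm_of_nonneg h0.le] at this
    linarith
  refine ⟨by linarith, ?_⟩
  have : w - ζ = (w - r * ζ) - (1 - r) * ζ := by ring
  have h2 : ‖((1:ℂ) - r) * ζ‖ = 1 - r := by
    rw [norm_mul, hζ, mul_one, ← Complex.ofReal_one, ← Complex.ofReal_sub, Complex.norm_real, Real.norm_of_nonneg (by linarith)]
  calc ‖w - ζ‖ ≤ ‖w - r * ζ‖ + ‖((1:ℂ) - r) * ζ‖ := by rw [this]; exact norm_sub_le _ _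
    _ ≤ 2 * ‖w - r * ζ‖ := by rw [h2]; linarith

lemma fz_swap {w ζ : ℂ} (hw : ‖w‖ = 1) (hζ : ‖ζ‖ = 1) (r : ℝ) : ‖r * w - ζ‖ = ‖w - r * ζ‖ := by
  rw [← sq_eq_sq₀ (norm_nonneg _) (norm_nonneg _)]
  rw [← Complex.normSq_eq_norm_sq, ← Complex.normSq_eq_norm_sq, Complex.normSq_sub, Complex.normSq_sub,
    Complex.normSq_mul, Complex.normSq_mul, Complex.normSq_eq_norm_sq w, Complex.normSq_eq_norm_sq ζ, hw, hζ]
  simp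
  ring

/-- pointwise kernel estimate -/
lemma fz_kernel {w ζ : ℂ} (hw : ‖w‖ = 1) (hζ : ‖ζ‖ = 1) {r : ℝ} (h0 : 0 < r) (h1 : r < 1) :
    ‖w - ζ‖ * ‖1 / (w - r * ζ) ^ 2 - 1 / (w - ζ / r) ^ 2‖ ≤ 4 * ((1 - r ^ 2) / ‖w - r * ζ‖ ^ 2) := by
  set a := ‖w - r * ζ‖ with ha
  have ⟨hapos, hwz⟩ : 0 < a ∧ ‖w - ζ‖ ≤ 2 * a := fz_two hw hζ h0 h1
  have hrc : (r:ℂ) ≠ 0 := by exact_mod_cast h0.ne'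
  have hb : ‖w - ζ / r‖ = a / r := by
    have e1 : ‖r * w - ζ‖ = a := fz_swap hw hζ r
    rw [← e1, show w - ζ / r = (r * w - ζ) / r by field_simp, norm_div, Complex.norm_real, Real.norm_of_nonneg h0.le]
  have hn1 : w - r * ζ ≠ 0 := norm_pos_iff.1 hapos
  have hn2 : w - ζ / r ≠ 0 := by rw [← norm_pos_iff, hb]; positivity
  have hK : 1 / (w - r * ζ) ^ 2 - 1 / (w - ζ / r) ^ 2 =
      ((r * ζ - ζ / r) * ((w - r * ζ) + (w - ζ / r))) / ((w - r * ζ) ^ 2 * (w - ζ / r) ^ 2) := by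
    rw [div_sub_div _ _ (pow_ne_zero _ hn1) (pow_ne_zero _ hn2)]
    congr 1; ring
  have h3 : ‖r * ζ - ζ / r‖ = (1 - r ^ 2) / r := by
    have : r * ζ - ζ / r = (((r ^ 2 - 1) / r : ℝ) : ℂ) * ζ := by push_cast; field_simp
    rw [this, norm_mul, hζ, mul_one, Complex.norm_real, Real.norm_eq_abs, abs_div, abs_of_pos h0, abs_of_nonpos (by nlinarith)]
    ring
  have h4 : ‖(w - r * ζ) + (w - ζ / r)‖ ≤ a + a / r := by
    rw [← hb]; exact norm_add_le _ _
  rw [hK, norm_div, norm_mul, norm_mul, norm_pow, norm_pow, hb, h3, ← ha]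
  have hr2 : 0 < 1 - r ^ 2 := by nlinarith
  calc ‖w - ζ‖ * ((1 - r ^ 2) / r * ‖(w - r * ζ) + (w - ζ / r)‖ / (a ^ 2 * (a / r) ^ 2))
      ≤ (2 * a) * ((1 - r ^ 2) / r * (a + a / r) / (a ^ 2 * (a / r) ^ 2)) := by gcongr
    _ = (2 * (1 + r)) * ((1 - r ^ 2) / a ^ 2) := by field_simp; ring
    _ ≤ 4 * ((1 - r ^ 2) / a ^ 2) := by gcongr; linarith

lemma fz_key {g : ℂ → ℂ} (hg : DiffContOnCl ℂ g (Metric.ball 0 1)) {ζ : ℂ} (hζ : ‖ζ‖ = 1) {M : ℝ}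
    (hM : ∀ w : ℂ, ‖w‖ = 1 → ‖g w‖ ≤ M)
    (hsm : ∀ ε > 0, ∃ δ > 0, ∀ w : ℂ, ‖w‖ = 1 → ‖w - ζ‖ < δ → ‖g w‖ ≤ ε * ‖w - ζ‖) :
    Tendsto (fun r : ℝ => deriv g (r * ζ)) (𝓝[<] (1:ℝ)) (𝓝 0) := by
  have hM0 : 0 ≤ M := (norm_nonneg _).trans (hM 1 (by simp))
  have main : ∀ ε > 0, ∃ C : ℝ, ∀ r : ℝ, 0 < r → r < 1 → ‖deriv g (r * ζ)‖ ≤ 4 * ε + C * (1 - r ^ 2) := by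
    intro ε hε
    obtain ⟨δ, hδ, hs⟩ := hsm ε hε
    refine ⟨16 * M / δ ^ 3, fun r h0 h1 => ?_⟩
    have hr2 : 0 < 1 - r ^ 2 := by nlinarith
    have hrz : ‖(r:ℂ) * ζ‖ = r := by
      rw [norm_mul, hζ, mul_one, Complex.norm_real, Real.norm_of_nonneg h0.le]
    have hzr : 1 < ‖ζ / (r:ℂ)‖ := by
      rw [norm_div, hζ, Complex.norm_real, Real.norm_of_nonneg h0.le]
      exact (one_lt_div h0).2 h1
    have e1 := fz_cauchy_deriv hg (z := r * ζ) (by rw [hrz]; exact h1)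
    have e2 := fz_cauchy_out hg hzr
    have hgc : ContinuousOn g (Metric.sphere 0 1) :=
      hg.continuousOn_ball.mono Metric.sphere_subset_closedBall
    have hcc : ∀ z : ℂ, ‖z‖ ≠ 1 → ContinuousOn (fun w : ℂ => g w * (1 / (w - z) ^ 2)) (Metric.sphere 0 1) := by
      intro z hz
      refine hgc.mul (ContinuousOn.div continuousOn_const (by fun_prop) ?_)
      intro w hw h
      have : w = z := sub_eq_zero.1 (pow_eq_zero_iff (two_ne_zero) |>.1 h)
      subst this
      simp at hw; exact hz hw
    have e3 : (∮ w in C(0, 1), g w * (1 / (w - r * ζ) ^ 2 - 1 / (w - ζ / r) ^ 2))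
        = (2 * Real.pi * I : ℂ) * deriv g (r * ζ) := by
      rw [← e1]
      refine Eq.trans ?_ (sub_eq_self.2 e2)
      rw [← circleIntegral.integral_sub]
      · simp only [mul_sub]
      · exact (hcc _ (by rw [hrz]; exact h1.ne)).circleIntegrable (by norm_num)
      · exact (hcc _ hzr.ne').circleIntegrable (by norm_num)
    have e4 : ‖∮ w in C(0, 1), g w * (1 / (w - r * ζ) ^ 2 - 1 / (w - ζ / r) ^ 2)‖
        ≤ ∫ t in (0:ℝ)..(2 * Real.pi), (4 * ε * ((1 - ‖r * ζ‖ ^ 2) / ‖circleMap 0 1 t - r * ζ‖ ^ 2)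
          + 16 * M / δ ^ 3 * (1 - r ^ 2)) := by
      rw [circleIntegral]
      apply intervalIntegral.norm_integral_le_of_norm_le (by positivity)
      · refine Eventually.of_forall fun t _ => ?_
        have hw : ‖circleMap 0 1 t‖ = 1 := by simp
        set w := circleMap 0 1 t
        have hd : ‖deriv (circleMap 0 1) t‖ = 1 := by simp
        rw [norm_smul, hd, one_mul, norm_mul, hrz]
        have hk := fz_kernel hw hζ h0 h1
        obtain ⟨ha, hb⟩ := fz_two hw hζ h0 h1
        set K := ‖1 / (w - r * ζ) ^ 2 - 1 / (w - ζ / r) ^ 2‖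
        have hK : 0 ≤ K := norm_nonneg _
        by_cases hwd : ‖w - ζ‖ < δ
        · have h5 : 0 ≤ 16 * M / δ ^ 3 * (1 - r ^ 2) := by positivity
          calc ‖g w‖ * K ≤ (ε * ‖w - ζ‖) * K := by gcongr; exact hs w hw hwd
            _ = ε * (‖w - ζ‖ * K) := by ring
            _ ≤ ε * (4 * ((1 - r ^ 2) / ‖w - r * ζ‖ ^ 2)) := by gcongr
            _ ≤ _ := by linarith
        · push Not at hwd
          have h5 : 0 ≤ 4 * ε * ((1 - r ^ 2) / ‖w - r * ζ‖ ^ 2) := by positivity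
          have h6 : δ / 2 ≤ ‖w - r * ζ‖ := by linarith
          calc ‖g w‖ * K ≤ M * K := by gcongr; exact hM w hw
            _ = M / δ * (δ * K) := by field_simp
            _ ≤ M / δ * (‖w - ζ‖ * K) := by gcongr
            _ ≤ M / δ * (4 * ((1 - r ^ 2) / ‖w - r * ζ‖ ^ 2)) := by gcongr
            _ ≤ M / δ * (4 * ((1 - r ^ 2) / (δ / 2) ^ 2)) := by gcongr
            _ = 16 * M / δ ^ 3 * (1 - r ^ 2) := by field_simp; ring
            _ ≤ _ := by linarith
      · apply Continuous.intervalIntegrable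
        refine Continuous.add (continuous_const.mul (Continuous.div continuous_const (by fun_prop) ?_)) continuous_const
        intro t
        exact pow_ne_zero _ (fz_two (by simp) hζ h0 h1).1.ne'
    rw [e3, intervalIntegral.integral_add, intervalIntegral.integral_const_mul,
      fz_poisson_int (by rw [hrz]; exact h1), intervalIntegral.integral_const] at e4
    · have hpi := Real.pi_pos
      rw [norm_mul] at e4
      have : ‖(2 * Real.pi * I : ℂ)‖ = 2 * Real.pi := by simp [abs_of_pos hpi]
      rw [this, smul_eq_mul, sub_zero] at e4
      have : 2 * Real.pi * ‖deriv g (r * ζ)‖ ≤ 2 * Real.pi * (4 * ε + 16 * M / δ ^ 3 * (1 - r ^ 2)) := by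
        linarith
      exact le_of_mul_le_mul_left this (by positivity)
    · apply Continuous.intervalIntegrable
      refine (continuous_const.mul (Continuous.div continuous_const (by fun_prop) ?_))
      intro t
      exact pow_ne_zero _ (fz_two (by simp) hζ h0 h1).1.ne'
    · exact _root_.intervalIntegrable_const
  rw [Metric.tendsto_nhds]
  intro ε hε
  obtain ⟨C, hC⟩ := main (ε / 8) (by positivity)
  have h1 : Tendsto (fun r : ℝ => 4 * (ε / 8) + C * (1 - r ^ 2)) (𝓝[<] (1:ℝ)) (𝓝 (4 * (ε / 8) + C * (1 - 1 ^ 2))) := by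
    apply Tendsto.mono_left _ nhdsWithin_le_nhds
    exact Continuous.tendsto (by fun_prop) 1
  have h2 := h1.eventually_lt_const (show 4 * (ε / 8) + C * (1 - 1 ^ 2) < ε by linarith)
  filter_upwards [h2, Ioo_mem_nhdsLT (show (0:ℝ) < 1 by norm_num)] with r hr hr'
  rw [dist_zero_right]
  exact (hC r hr'.1 hr'.2).trans_lt hr

lemma fz_fatou {f : ℂ → ℂ} (hf : DifferentiableOn ℂ f (Metric.ball 0 1)) (hb : ∀ z ∈ Metric.ball (0:ℂ) 1, ‖f z‖ ≤ 1) :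
    ∀ᵐ t : ℝ, ∃ L, Tendsto (fun r : ℝ => f (r * Complex.exp (t * I))) (𝓝[<] (1:ℝ)) (𝓝 L) := by
  obtain ⟨F, hF⟩ := hf.isExactOn_ball
  have hL : LipschitzOnWith 1 F (Metric.ball 0 1) :=
    (convex_ball (0:ℂ) 1).lipschitzOnWith_of_nnnorm_hasDerivWithin_le
      (fun z hz => (hF z hz).hasDerivWithinAt) (fun z hz => by exact_mod_cast hb z hz)
  obtain ⟨G, hG, hFG⟩ := hL.extend_finite_dimension
  have hGd : ∀ z ∈ Metric.ball (0:ℂ) 1, HasDerivAt G (f z) z := by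
    intro z hz
    refine (hF z hz).congr_of_eventuallyEq ?_
    filter_upwards [Metric.isOpen_ball.mem_nhds hz] with y hy using (hFG hy).symm
  have hE : LipschitzWith 1 (fun t : ℝ => Complex.exp (t * I)) := by
    apply lipschitzWith_of_nnnorm_deriv_le (𝕜 := ℝ)
    · fun_prop
    · intro t
      have : HasDerivAt (fun t : ℝ => Complex.exp (t * I)) (Complex.exp (t * I) * (1 * I)) t :=
        ((hasDerivAt_id (t:ℂ)).mul_const I).cexp.comp_ofReal
      rw [this.deriv, ← NNReal.coe_le_coe]
      simp [Complex.norm_exp_ofReal_mul_I]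
  filter_upwards [(hG.comp hE).ae_differentiableAt_real] with t ht
  obtain ⟨D, hD⟩ : ∃ D, HasDerivAt (fun t : ℝ => G (Complex.exp (t * I))) D t := ⟨_, ht.hasDerivAt⟩
  set ζ := Complex.exp (t * I) with hζ
  have hζ1 : ‖ζ‖ = 1 := Complex.norm_exp_ofReal_mul_I t
  have hζ0 : ζ ≠ 0 := Complex.exp_ne_zero _
  set c := D / (ζ * I) with hc
  refine ⟨c, ?_⟩
  set g : ℂ → ℂ := fun w => G w - G ζ - c * (w - ζ) with hg
  have hgd : ∀ z ∈ Metric.ball (0:ℂ) 1, HasDerivAt g (f z - c) z := by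
    intro z hz
    have := ((hGd z hz).sub_const (G ζ)).sub (((hasDerivAt_id z).sub_const ζ).const_mul c)
    rw [mul_one] at this
    exact this
  have hgcont : Continuous g := by
    have := hG.continuous
    fun_prop
  have hdc : DiffContOnCl ℂ g (Metric.ball 0 1) :=
    ⟨fun z hz => (hgd z hz).differentiableAt.differentiableWithinAt, hgcont.continuousOn⟩
  obtain ⟨M, hM⟩ : ∃ M, ∀ w ∈ Metric.sphere (0:ℂ) 1, ‖g w‖ ≤ M :=
    (isCompact_sphere (0:ℂ) 1).exists_bound_of_continuousOn hgcont.continuousOn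
  have hsm : ∀ ε > 0, ∃ δ > 0, ∀ w : ℂ, ‖w‖ = 1 → ‖w - ζ‖ < δ → ‖g w‖ ≤ ε * ‖w - ζ‖ := by
    intro ε hε
    have hh : HasDerivAt (fun s : ℝ => g (Complex.exp (s * I))) 0 t := by
      have h1 : HasDerivAt (fun t : ℝ => Complex.exp (t * I)) (Complex.exp (t * I) * (1 * I)) t :=
        ((hasDerivAt_id (t:ℂ)).mul_const I).cexp.comp_ofReal
      have h2 := (hD.sub_const (G ζ)).sub ((h1.sub_const ζ).const_mul c)
      have h3 : D - c * (Complex.exp (t * I) * (1 * I)) = 0 := by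
        rw [← hζ, hc, one_mul, div_mul_cancel₀, sub_self]
        exact mul_ne_zero hζ0 I_ne_zero
      rw [h3] at h2
      exact h2
    have hlo := hh.isLittleO.def (show 0 < ε * (2 / Real.pi) by positivity)
    rw [Metric.eventually_nhds_iff] at hlo
    obtain ⟨δ, hδ, hlo⟩ := hlo
    refine ⟨δ * (2 / Real.pi), by positivity, fun w hw hwd => ?_⟩
    have hang := Complex.angle_le_mul_norm_sub hw hζ1
    have hw0 : w ≠ 0 := by rw [← norm_pos_iff, hw]; norm_num
    rw [Complex.angle_eq_abs_arg hw0 hζ0] at hang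
    set s := (w / ζ).arg
    have hws : Complex.exp (((t + s : ℝ) : ℂ) * I) = w := by
      have : ‖w / ζ‖ = 1 := by rw [norm_div, hw, hζ1, div_one]
      have h3 := Complex.norm_mul_exp_arg_mul_I (w / ζ)
      rw [this, Complex.ofReal_one, one_mul] at h3
      rw [Complex.ofReal_add, add_mul, Complex.exp_add, ← hζ, h3]
      field_simp
    have hpi := Real.pi_pos
    have hsd : |s| < δ := by
      refine hang.trans_lt ?_
      calc Real.pi / 2 * ‖w - ζ‖ < Real.pi / 2 * (δ * (2 / Real.pi)) := by gcongr
        _ = δ := by field_simp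
    have h4 := hlo (y := t + s) (by simpa using hsd)
    rw [hws, ← hζ] at h4
    have hgζ : g ζ = 0 := by simp [hg]
    rw [hgζ] at h4
    simp only [smul_zero, sub_zero, add_sub_cancel_left, Real.norm_eq_abs] at h4
    calc ‖g w‖ ≤ ε * (2 / Real.pi) * |s| := h4
      _ ≤ ε * (2 / Real.pi) * (Real.pi / 2 * ‖w - ζ‖) := by gcongr
      _ = ε * ‖w - ζ‖ := by field_simp
  have hk := fz_key hdc hζ1 (fun w hw => hM w (by simpa using hw)) hsm
  have : Tendsto (fun r : ℝ => deriv g (r * ζ) + c) (𝓝[<] (1:ℝ)) (𝓝 (0 + c)) := hk.add_const c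
  rw [zero_add] at this
  refine this.congr' ?_
  filter_upwards [Ioo_mem_nhdsLT (show (0:ℝ) < 1 by norm_num)] with r hr
  rw [(hgd (r * ζ) ?_).deriv]
  · ring
  · simp [hζ1, abs_of_pos hr.1, hr.2]


lemma fz_closed_torus (d : ℕ) : IsClosed (polyTorus d) := by
  have : polyTorus d = ⋂ j, {z : Fin d → ℂ | ‖z j‖ = 1} := by
    ext z; simp [polyTorus]
  rw [this]
  exact isClosed_iInter fun j => isClosed_eq (by fun_prop) continuous_const

lemma fz_scale_mem {d : ℕ} {ζ : Fin d → ℂ} (hζ : ζ ∈ polyTorus d) {z : ℂ} (hz : ‖z‖ < 1) :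
    (fun j => z * ζ j) ∈ polyDisk d := by
  intro j
  rw [norm_mul, hζ j, mul_one]
  exact hz

def fzGood (d : ℕ) (φ : (Fin d → ℂ) → ℂ) : Set (Fin d → ℂ) :=
  ⋂ k : ℕ, ⋃ n : ℕ, {ζ | ζ ∈ polyTorus d ∧ ∀ r ∈ Set.Ioo (1 - 1 / ((n:ℝ) + 1)) 1,
    ∀ r' ∈ Set.Ioo (1 - 1 / ((n:ℝ) + 1)) 1,
      dist (φ (fun j => (r:ℂ) * ζ j)) (φ (fun j => (r':ℂ) * ζ j)) ≤ 1 / ((k:ℝ) + 1)}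

lemma fz_cont_scale {d : ℕ} {φ : (Fin d → ℂ) → ℂ} (hφ : DifferentiableOn ℂ φ (polyDisk d)) {r : ℝ}
    (h0 : 0 ≤ r) (h1 : r < 1) : ContinuousOn (fun ζ : Fin d → ℂ => φ (fun j => (r:ℂ) * ζ j)) (polyTorus d) := by
  refine hφ.continuousOn.comp (by fun_prop) ?_
  intro ζ hζ
  exact fz_scale_mem hζ (by rw [Complex.norm_real, Real.norm_of_nonneg h0]; exact h1)

lemma fz_nonneg_of_mem {n : ℕ} {r : ℝ} (hr : r ∈ Set.Ioo (1 - 1 / ((n:ℝ) + 1)) 1) : 0 ≤ r := by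
  have : 1 / ((n:ℝ) + 1) ≤ 1 := by
    rw [div_le_one (by positivity)]
    have : (0:ℝ) ≤ n := Nat.cast_nonneg n
    linarith
  linarith [hr.1]

lemma fzGood_meas {d : ℕ} {φ : (Fin d → ℂ) → ℂ} (hφ : DifferentiableOn ℂ φ (polyDisk d)) :
    MeasurableSet (fzGood d φ) := by
  refine MeasurableSet.iInter fun k => MeasurableSet.iUnion fun n => IsClosed.measurableSet ?_
  set J := Set.Ioo (1 - 1 / ((n:ℝ) + 1)) 1
  have e : {ζ | ζ ∈ polyTorus d ∧ ∀ r ∈ J, ∀ r' ∈ J,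
      dist (φ (fun j => (r:ℂ) * ζ j)) (φ (fun j => (r':ℂ) * ζ j)) ≤ 1 / ((k:ℝ) + 1)} =
      polyTorus d ∩ ⋂ r ∈ J, ⋂ r' ∈ J, (polyTorus d ∩ (fun ζ : Fin d → ℂ =>
        dist (φ (fun j => (r:ℂ) * ζ j)) (φ (fun j => (r':ℂ) * ζ j))) ⁻¹' Set.Iic (1 / ((k:ℝ) + 1))) := by
    ext ζ
    simp only [Set.mem_ofPred_eq, Set.mem_inter_iff, Set.mem_iInter, Set.mem_preimage, Set.mem_Iic]
    exact ⟨fun h => ⟨h.1, fun r hr r' hr' => ⟨h.1, h.2 r hr r' hr'⟩⟩,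
      fun h => ⟨h.1, fun r hr r' hr' => (h.2 r hr r' hr').2⟩⟩
  rw [e]
  refine (fz_closed_torus d).inter (isClosed_biInter fun r hr => isClosed_biInter fun r' hr' => ?_)
  refine ContinuousOn.preimage_isClosed_of_isClosed ?_ (fz_closed_torus d) isClosed_Iic
  exact continuous_dist.comp_continuousOn
    ((fz_cont_scale hφ (fz_nonneg_of_mem hr) hr.2).prodMk (fz_cont_scale hφ (fz_nonneg_of_mem hr') hr'.2))

lemma fzGood_of_lim {d : ℕ} {φ : (Fin d → ℂ) → ℂ} {ζ : Fin d → ℂ} (hζ : ζ ∈ polyTorus d)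
    (h : ∃ L, HasRadialLimit d φ ζ L) : ζ ∈ fzGood d φ := by
  obtain ⟨L, hL⟩ := h
  rw [fzGood, Set.mem_iInter]
  intro k
  rw [Set.mem_iUnion]
  have hev := Metric.tendsto_nhds.1 hL (1 / ((k:ℝ) + 1) / 2) (by positivity)
  obtain ⟨a, ha, hev⟩ := (mem_nhdsLT_iff_exists_Ioo_subset (a := (1:ℝ))).1 hev
  have ha' : (0:ℝ) < 1 - a := sub_pos.2 ha
  obtain ⟨n, hn⟩ := exists_nat_one_div_lt ha'
  refine ⟨n, hζ, fun r hr r' hr' => ?_⟩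
  have h1 := hev (show r ∈ Set.Ioo a 1 from ⟨by linarith [hr.1], hr.2⟩)
  have h2 := hev (show r' ∈ Set.Ioo a 1 from ⟨by linarith [hr'.1], hr'.2⟩)
  simp only [Set.mem_ofPred_eq] at h1 h2
  have h3 := dist_triangle_right (φ (fun j => (r:ℂ) * ζ j)) (φ (fun j => (r':ℂ) * ζ j)) L
  linarith

lemma fzGood_lim {d : ℕ} {φ : (Fin d → ℂ) → ℂ} {ζ : Fin d → ℂ} (h : ζ ∈ fzGood d φ) :
    ζ ∈ polyTorus d ∧ ∃ L, HasRadialLimit d φ ζ L := by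
  rw [fzGood, Set.mem_iInter] at h
  have hT : ζ ∈ polyTorus d := by
    obtain ⟨n, hn⟩ := Set.mem_iUnion.1 (h 0)
    exact hn.1
  refine ⟨hT, ?_⟩
  have : Cauchy (map (fun r : ℝ => φ (fun j => (r : ℂ) * ζ j)) (𝓝[<] (1:ℝ))) := by
    rw [Metric.cauchy_iff]
    refine ⟨inferInstance, fun ε hε => ?_⟩
    obtain ⟨k, hk⟩ := exists_nat_one_div_lt hε
    obtain ⟨n, hn⟩ := Set.mem_iUnion.1 (h k)
    refine ⟨_, image_mem_map (Ioo_mem_nhdsLT (show 1 - 1 / ((n:ℝ) + 1) < 1 by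
      have : 0 < 1 / ((n:ℝ) + 1) := by positivity
      linarith)), ?_⟩
    rintro _ ⟨r, hr, rfl⟩ _ ⟨r', hr', rfl⟩
    exact (hn.2 r hr r' hr').trans_lt hk
  obtain ⟨L, hL⟩ := CompleteSpace.complete this
  exact ⟨L, hL⟩

lemma fz_exists_lim {d : ℕ} {φ : (Fin d → ℂ) → ℂ} (hφ : DifferentiableOn ℂ φ (polyDisk d))
    (hb : ∀ z ∈ polyDisk d, ‖φ z‖ < 1) :
    ∀ᵐ ζ ∂(torusLebesgue d), ζ ∈ polyTorus d ∧ ∃ L, HasRadialLimit d φ ζ L := by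
  suffices h : ∀ᵐ ζ ∂(torusLebesgue d), ζ ∈ fzGood d φ from h.mono fun ζ hζ => fzGood_lim hζ
  have hem : Measurable (fun θ : Fin d → ℝ => fun j => Complex.exp ((θ j : ℂ) * Complex.I)) := by
    fun_prop
  refine Measure.ae_smul_measure ?_ _
  refine (ae_map_iff (p := fun ζ => ζ ∈ fzGood d φ) hem.aemeasurable (fzGood_meas hφ)).2 ?_
  apply ae_restrict_of_ae
  refine ae_mem_of_ae_add_linearMap_mem (𝕜 := ℝ) (LinearMap.pi fun _ => LinearMap.id : ℝ →ₗ[ℝ] (Fin d → ℝ)) volume volume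
    (s := (fun θ : Fin d → ℝ => fun j => Complex.exp ((θ j : ℂ) * Complex.I)) ⁻¹' fzGood d φ)
    (hem (fzGood_meas hφ)) ?_
  intro y
  have hy : (fun j => Complex.exp ((y j : ℂ) * Complex.I)) ∈ polyTorus d :=
    fun j => Complex.norm_exp_ofReal_mul_I _
  have hmaps : ∀ z ∈ Metric.ball (0:ℂ) 1, (fun j => z * Complex.exp ((y j : ℂ) * Complex.I)) ∈ polyDisk d :=
    fun z hz => fz_scale_mem hy (by simpa using hz)
  have := fz_fatou (f := fun z => φ (fun j => z * Complex.exp ((y j : ℂ) * Complex.I)))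
    (hφ.comp (by fun_prop) hmaps) (fun z hz => (hb _ (hmaps z hz)).le)
  filter_upwards [this] with t ht
  obtain ⟨L, hL⟩ := ht
  refine fzGood_of_lim (fun j => Complex.norm_exp_ofReal_mul_I _) ⟨L, ?_⟩
  refine hL.congr fun r => ?_
  congr 1
  funext j
  simp only [Pi.add_apply, LinearMap.pi_apply, LinearMap.id_apply, Complex.ofReal_add, add_mul, Complex.exp_add]
  ring

def fzM : Measure ℂ :=
  (ENNReal.ofReal (2 * Real.pi))⁻¹ •
    Measure.map (fun t : ℝ => Complex.exp ((t : ℂ) * Complex.I)) (volume.restrict (Set.Ico 0 (2 * Real.pi)))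

lemma fz_exp_meas : Measurable (fun t : ℝ => Complex.exp ((t : ℂ) * Complex.I)) := by fun_prop

instance fzM_prob : IsProbabilityMeasure fzM := by
  constructor
  rw [fzM, Measure.smul_apply, Measure.map_apply fz_exp_meas MeasurableSet.univ]
  have : ENNReal.ofReal (2 * Real.pi) ≠ 0 := by
    simp [Real.pi_pos]
  simp only [Set.preimage_univ, Measure.restrict_apply_univ, Real.volume_Ico, sub_zero, smul_eq_mul]
  exact ENNReal.inv_mul_cancel this ENNReal.ofReal_ne_top

lemma fz_torus_pi (d : ℕ) : torusLebesgue d = Measure.pi (fun _ : Fin d => fzM) := by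
  symm
  apply Measure.pi_eq
  intro s hs
  have hem : Measurable (fun θ : Fin d → ℝ => fun j => Complex.exp ((θ j : ℂ) * Complex.I)) := by
    fun_prop
  rw [torusLebesgue, Measure.smul_apply, Measure.map_apply hem (MeasurableSet.univ_pi hs)]
  have e : (fun θ : Fin d → ℝ => fun j => Complex.exp ((θ j : ℂ) * Complex.I)) ⁻¹' (Set.univ.pi s) =
      Set.univ.pi fun j => (fun t : ℝ => Complex.exp ((t : ℂ) * Complex.I)) ⁻¹' s j := by
    ext; simp
  rw [e, volume_pi, Measure.restrict_pi_pi, Measure.pi_pi]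
  simp only [fzM, Measure.smul_apply, smul_eq_mul]
  rw [Finset.prod_mul_distrib, Finset.prod_const, Finset.card_univ, Fintype.card_fin,
    ENNReal.ofReal_pow (by positivity), ENNReal.inv_pow]
  congr 1
  refine Finset.prod_congr rfl fun j _ => ?_
  rw [Measure.map_apply fz_exp_meas (hs j)]

instance fz_torus_prob (d : ℕ) : IsProbabilityMeasure (torusLebesgue d) := by
  rw [fz_torus_pi]; infer_instance

lemma fz_torus_ae (d : ℕ) : ∀ᵐ ζ ∂(torusLebesgue d), ζ ∈ polyTorus d := by
  have hem : Measurable (fun θ : Fin d → ℝ => fun j => Complex.exp ((θ j : ℂ) * Complex.I)) := by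
    fun_prop
  refine Measure.ae_smul_measure ?_ _
  refine (ae_map_iff (p := fun ζ => ζ ∈ polyTorus d) hem.aemeasurable (fz_closed_torus d).measurableSet).2 ?_
  exact Eventually.of_forall fun θ j => Complex.norm_exp_ofReal_mul_I _

lemma fzM_poisson {z : ℂ} (hz : ‖z‖ < 1) :
    ∫ w, (1 - ‖z‖ ^ 2) / ‖w - z‖ ^ 2 ∂fzM = 1 := by
  have hm : Measurable (fun w : ℂ => (1 - ‖z‖ ^ 2) / ‖w - z‖ ^ 2) := by fun_prop
  rw [fzM, integral_smul_measure, integral_map fz_exp_meas.aemeasurable hm.aestronglyMeasurable]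
  have h := fz_poisson_int hz
  rw [intervalIntegral.integral_of_le (by positivity), ← integral_Ico_eq_integral_Ioc] at h
  simp only [circleMap, Complex.ofReal_one, one_mul, zero_add] at h
  rw [h]
  have hpi := Real.pi_pos
  rw [ENNReal.toReal_inv, ENNReal.toReal_ofReal (by positivity), smul_eq_mul]
  field_simp

lemma fz_integrable_of_one {α : Type*} [MeasurableSpace α] {μ : Measure α} {f : α → ℝ}
    (h : ∫ x, f x ∂μ = 1) : Integrable f μ := by
  by_contra hn
  rw [integral_undef hn] at h
  norm_num at h

lemma fz_swap_poisson {d : ℕ} {ζ η : Fin d → ℂ} (hζ : ζ ∈ polyTorus d) (hη : η ∈ polyTorus d) (r : ℝ) :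
    poissonD d (fun j => (r:ℂ) * ζ j) η = poissonD d (fun j => (r:ℂ) * η j) ζ := by
  unfold poissonD
  refine Finset.prod_congr rfl fun j _ => ?_
  rw [norm_mul, norm_mul, hζ j, hη j, ← fz_swap (hη j) (hζ j) r, norm_sub_rev]

lemma fz_apx {d : ℕ} {η : Fin d → ℂ} (hη : η ∈ polyTorus d) {r : ℝ} (h0 : 0 < r) (h1 : r < 1)
    {f : (Fin d → ℂ) → ℝ} (hf : Measurable f) (hf0 : ∀ x, 0 ≤ f x) (hf1 : ∀ x, f x ≤ 1) :
    Integrable (fun ζ => f ζ * poissonD d (fun j => (r:ℂ) * η j) ζ) (torusLebesgue d) ∧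
    (∫ ζ, f ζ * poissonD d (fun j => (r:ℂ) * η j) ζ ∂(torusLebesgue d)) ≤ 1 ∧
    ∀ ε > 0, ∀ δ > 0, (∀ ζ, dist ζ η < δ → |f ζ - f η| ≤ ε) →
      |(∫ ζ, f ζ * poissonD d (fun j => (r:ℂ) * η j) ζ ∂(torusLebesgue d)) - f η| ≤
        ε + d * (4 * (1 - r ^ 2) / δ ^ 2) := by
  have hr2 : 0 < 1 - r ^ 2 := by nlinarith
  have hn : ∀ j, ‖(r:ℂ) * η j‖ = r := fun j => by
    rw [norm_mul, hη j, mul_one, Complex.norm_real, Real.norm_of_nonneg h0.le]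
  set q : Fin d → ℂ → ℝ := fun j w => (1 - ‖(r:ℂ) * η j‖ ^ 2) / ‖w - (r:ℂ) * η j‖ ^ 2 with hq
  have hq0 : ∀ j w, 0 ≤ q j w := fun j w => by
    simp only [hq]; rw [hn]; positivity
  set P : (Fin d → ℂ) → ℝ := fun ζ => poissonD d (fun j => (r:ℂ) * η j) ζ with hP
  have hPq : ∀ ζ, P ζ = ∏ j, q j (ζ j) := fun ζ => rfl
  have hP0 : ∀ ζ, 0 ≤ P ζ := fun ζ => Finset.prod_nonneg fun j _ => hq0 j _
  have hq1 : ∀ j, ∫ w, q j w ∂fzM = 1 := fun j => fzM_poisson (by rw [hn]; exact h1)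
  have hPint : ∫ ζ, P ζ ∂(torusLebesgue d) = 1 := by
    rw [fz_torus_pi]
    simp only [hPq]
    rw [integral_fintype_prod_eq_prod]
    simp [hq1]
  have hPi := fz_integrable_of_one hPint
  set R : Fin d → (Fin d → ℂ) → ℝ := fun j ζ => ∏ i, (if i = j then fun _ => 1 else q i) (ζ i) with hR
  have hR0 : ∀ j ζ, 0 ≤ R j ζ := fun j ζ => Finset.prod_nonneg fun i _ => by
    split_ifs
    · norm_num
    · exact hq0 i _
  have hRint : ∀ j, ∫ ζ, R j ζ ∂(torusLebesgue d) = 1 := by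
    intro j
    rw [fz_torus_pi]
    simp only [hR]
    rw [integral_fintype_prod_eq_prod (𝕜 := ℝ) (fun i => (if i = j then fun _ => 1 else q i))]
    refine Finset.prod_eq_one fun i _ => ?_
    split_ifs
    · simp
    · exact hq1 i
  have hRi := fun j => fz_integrable_of_one (hRint j)
  have hfP : Integrable (fun ζ => f ζ * P ζ) (torusLebesgue d) := by
    refine hPi.mono' (hf.aestronglyMeasurable.mul hPi.aestronglyMeasurable) (Eventually.of_forall fun ζ => ?_)
    rw [Real.norm_eq_abs, abs_of_nonneg (mul_nonneg (hf0 ζ) (hP0 ζ))]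
    exact mul_le_of_le_one_left (hP0 ζ) (hf1 ζ)
  refine ⟨hfP, ?_, ?_⟩
  · rw [← hPint]
    exact integral_mono hfP hPi fun ζ => mul_le_of_le_one_left (hP0 ζ) (hf1 ζ)
  intro ε hε δ hδ hcont
  have e1 : (∫ ζ, f ζ * P ζ ∂(torusLebesgue d)) - f η = ∫ ζ, (f ζ - f η) * P ζ ∂(torusLebesgue d) := by
    simp only [sub_mul]
    rw [integral_sub hfP (hPi.const_mul _), integral_const_mul, hPint, mul_one]
  have hbi : Integrable (fun ζ => ε * P ζ + ∑ j, 4 * (1 - r ^ 2) / δ ^ 2 * R j ζ) (torusLebesgue d) :=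
    (hPi.const_mul _).add (integrable_finsetSum _ fun j _ => (hRi j).const_mul _)
  have e2 : ∫ ζ, (ε * P ζ + ∑ j, 4 * (1 - r ^ 2) / δ ^ 2 * R j ζ) ∂(torusLebesgue d) =
      ε + d * (4 * (1 - r ^ 2) / δ ^ 2) := by
    rw [integral_add (hPi.const_mul _) (integrable_finsetSum _ fun j _ => (hRi j).const_mul _),
      integral_finsetSum _ fun j _ => (hRi j).const_mul _, integral_const_mul, hPint]
    simp only [integral_const_mul, hRint]
    simp
  rw [e1, ← e2, ← Real.norm_eq_abs]
  refine norm_integral_le_of_norm_le hbi ?_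
  filter_upwards [fz_torus_ae d] with ζ hζ
  rw [norm_mul, Real.norm_eq_abs, Real.norm_of_nonneg (hP0 ζ)]
  have hterm : ∀ j, 0 ≤ 4 * (1 - r ^ 2) / δ ^ 2 * R j ζ := fun j => by
    have := hR0 j ζ
    positivity
  by_cases hd : dist ζ η < δ
  · have := Finset.sum_nonneg fun j (_ : j ∈ Finset.univ) => hterm j
    have h5 : |f ζ - f η| * P ζ ≤ ε * P ζ := mul_le_mul_of_nonneg_right (hcont ζ hd) (hP0 ζ)
    linarith
  · rw [dist_pi_lt_iff hδ] at hd
    push Not at hd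
    obtain ⟨j, hj⟩ := hd
    rw [dist_eq_norm] at hj
    have hPR : P ζ = q j (ζ j) * R j ζ := by
      rw [hPq, ← Finset.mul_prod_erase _ _ (Finset.mem_univ j)]
      simp only [hR]
      rw [← Finset.mul_prod_erase Finset.univ (fun i => (if i = j then fun _ => (1:ℝ) else q i) (ζ i)) (Finset.mem_univ j)]
      simp only [if_true, one_mul]
      congr 1
      refine Finset.prod_congr rfl fun i hi => ?_
      rw [if_neg (Finset.ne_of_mem_erase hi)]
    obtain ⟨ha, hb⟩ := fz_two (hζ j) (hη j) h0 h1
    have h6 : δ / 2 ≤ ‖ζ j - r * η j‖ := by linarith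
    have hqj : q j (ζ j) ≤ 4 * (1 - r ^ 2) / δ ^ 2 := by
      simp only [hq]; rw [hn]
      calc (1 - r ^ 2) / ‖ζ j - r * η j‖ ^ 2 ≤ (1 - r ^ 2) / (δ / 2) ^ 2 := by gcongr
        _ = _ := by field_simp; ring
    have habs : |f ζ - f η| ≤ 1 := by
      rw [abs_le]; constructor <;> linarith [hf0 ζ, hf0 η, hf1 ζ, hf1 η]
    have hε0 : 0 ≤ ε * P ζ := mul_nonneg hε.le (hP0 ζ)
    calc |f ζ - f η| * P ζ ≤ 1 * P ζ := mul_le_mul_of_nonneg_right habs (hP0 ζ)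
      _ = q j (ζ j) * R j ζ := by rw [one_mul, hPR]
      _ ≤ 4 * (1 - r ^ 2) / δ ^ 2 * R j ζ := mul_le_mul_of_nonneg_right hqj (hR0 j ζ)
      _ ≤ ∑ j, 4 * (1 - r ^ 2) / δ ^ 2 * R j ζ := Finset.single_le_sum (fun j _ => hterm j) (Finset.mem_univ j)
      _ ≤ _ := by linarith

def fzr (n : ℕ) : ℝ := 1 - 1 / ((n:ℝ) + 2)

lemma fzr_pos (n : ℕ) : 0 < fzr n := by
  have : 1 / ((n:ℝ) + 2) < 1 := by
    rw [div_lt_one (by positivity)]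
    have : (0:ℝ) ≤ n := Nat.cast_nonneg n
    linarith
  unfold fzr; linarith

lemma fzr_lt (n : ℕ) : fzr n < 1 := by
  have : 0 < 1 / ((n:ℝ) + 2) := by positivity
  unfold fzr; linarith

lemma fzr_tendsto : Tendsto fzr atTop (𝓝 1) := by
  have h : Tendsto (fun n : ℕ => 1 / (((n + 1 : ℕ) : ℝ) + 1)) atTop (𝓝 0) :=
    (tendsto_add_atTop_iff_nat 1).2 (tendsto_one_div_add_atTop_nhds_zero_nat (𝕜 := ℝ))
  have h2 := h.const_sub 1
  rw [sub_zero] at h2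
  refine h2.congr fun n => ?_
  unfold fzr
  push_cast
  ring_nf

def fzU (d : ℕ) (μ : Measure (Fin d → ℂ)) (n : ℕ) (ζ : Fin d → ℂ) : ENNReal :=
  ∫⁻ η, ENNReal.ofReal (poissonD d (fun j => (fzr n : ℂ) * ζ j) η) ∂μ

lemma fz_poisson_meas (d : ℕ) (r : ℝ) :
    Measurable (fun p : (Fin d → ℂ) × (Fin d → ℂ) => poissonD d (fun j => (r : ℂ) * p.1 j) p.2) := by
  unfold poissonD
  fun_prop

lemma fzU_meas {d : ℕ} (μ : Measure (Fin d → ℂ)) [IsProbabilityMeasure μ] (n : ℕ) : Measurable (fzU d μ n) :=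
  (fz_poisson_meas d (fzr n)).ennreal_ofReal.lintegral_prod_right'

lemma fz_poisson_meas2 (d : ℕ) (z : Fin d → ℂ) : Measurable (poissonD d z) := by
  unfold poissonD
  fun_prop

lemma fz_swapint {X Y : Type*} [MeasurableSpace X] [MeasurableSpace Y] (m : Measure X) (μ : Measure Y)
    [SFinite m] [SFinite μ] {g : X → ENNReal} (hg : Measurable g) {k : X → Y → ENNReal}
    (hk : Measurable (fun p : X × Y => k p.1 p.2)) (hk2 : ∀ x, Measurable (k x)) :
    ∫⁻ x, g x * ∫⁻ y, k x y ∂μ ∂m = ∫⁻ y, ∫⁻ x, g x * k x y ∂m ∂μ := by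
  have h1 : ∀ x, g x * ∫⁻ y, k x y ∂μ = ∫⁻ y, g x * k x y ∂μ := fun x =>
    (lintegral_const_mul _ (hk2 x)).symm
  simp only [h1]
  exact lintegral_lintegral_swap (f := fun x y => g x * k x y)
    ((hg.comp measurable_fst).mul hk).aemeasurable

lemma fz_weak {d : ℕ} (μ : Measure (Fin d → ℂ)) [IsProbabilityMeasure μ] (hμ : ∀ᵐ η ∂μ, η ∈ polyTorus d)
    {f : (Fin d → ℂ) → NNReal} (hf : Continuous f) (hf1 : ∀ x, f x ≤ 1) :
    ∫⁻ ζ, f ζ * liminf (fun n => fzU d μ n ζ) atTop ∂(torusLebesgue d) ≤ ∫⁻ η, f η ∂μ := by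
  set m := torusLebesgue d with hm
  have hfm : Measurable fun ζ => (f ζ : ENNReal) := hf.measurable.coe_nnreal_ennreal
  set A : ℕ → (Fin d → ℂ) → ENNReal := fun n η => ENNReal.ofReal
    (∫ ζ, (f ζ : ℝ) * poissonD d (fun j => (fzr n : ℂ) * η j) ζ ∂m) with hA
  have hfr : Measurable fun ζ => (f ζ : ℝ) := hf.measurable.coe_nnreal_real
  have hap := fun (n : ℕ) {η : Fin d → ℂ} (hη : η ∈ polyTorus d) => fz_apx hη (fzr_pos n) (fzr_lt n) hfr
    (fun x => (f x).2) (fun x => by exact_mod_cast hf1 x)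
  have hP0 : ∀ (n : ℕ) {η : Fin d → ℂ}, η ∈ polyTorus d → ∀ ζ, 0 ≤ poissonD d (fun j => (fzr n : ℂ) * η j) ζ := by
    intro n η hη ζ
    refine Finset.prod_nonneg fun j _ => div_nonneg ?_ (by positivity)
    rw [norm_mul, hη j, mul_one, Complex.norm_real, Real.norm_of_nonneg (fzr_pos n).le]
    nlinarith [fzr_pos n, fzr_lt n]
  have hAU : ∀ n, ∫⁻ ζ, f ζ * fzU d μ n ζ ∂m = ∫⁻ η, A n η ∂μ := by
    intro n
    have hk := (fz_poisson_meas d (fzr n)).ennreal_ofReal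
    have h1 := fz_swapint m μ hfm
      (k := fun ζ η => ENNReal.ofReal (poissonD d (fun j => (fzr n : ℂ) * ζ j) η)) hk
      (fun ζ => (fz_poisson_meas2 d _).ennreal_ofReal)
    refine Eq.trans h1 ?_
    refine lintegral_congr_ae ?_
    filter_upwards [hμ] with η hη
    rw [hA]
    simp only
    rw [ofReal_integral_eq_lintegral_ofReal (hap n hη).1
      (Eventually.of_forall fun ζ => mul_nonneg (f ζ).2 (hP0 n hη ζ))]
    refine lintegral_congr_ae ?_
    filter_upwards [fz_torus_ae d] with ζ hζ
    rw [ENNReal.ofReal_mul (NNReal.coe_nonneg _), fz_swap_poisson hζ hη, ENNReal.ofReal_coe_nnreal]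
  have hlim : Tendsto (fun n => ∫⁻ η, A n η ∂μ) atTop (𝓝 (∫⁻ η, f η ∂μ)) := by
    refine tendsto_lintegral_of_dominated_convergence' (fun _ => 1) ?_ ?_ (by simp) ?_
    · intro n
      have hk : Measurable (fun p : (Fin d → ℂ) × (Fin d → ℂ) =>
          (f p.2 : ℝ) * poissonD d (fun j => (fzr n : ℂ) * p.1 j) p.2) :=
        (hfr.comp measurable_snd).mul (fz_poisson_meas d (fzr n))
      exact (hk.stronglyMeasurable.integral_prod_right').measurable.ennreal_ofReal.aemeasurable
    · intro n
      filter_upwards [hμ] with η hη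
      rw [← ENNReal.ofReal_one]
      exact ENNReal.ofReal_le_ofReal (hap n hη).2.1
    · filter_upwards [hμ] with η hη
      rw [← ENNReal.ofReal_coe_nnreal]
      refine (ENNReal.continuous_ofReal.tendsto _).comp ?_
      rw [Metric.tendsto_atTop']
      intro ε hε
      have hfc : Continuous fun ζ => (f ζ : ℝ) := by fun_prop
      obtain ⟨δ, hδ, hδ'⟩ := Metric.continuousAt_iff.1 (hfc.continuousAt (x := η)) (ε / 2) (by positivity)
      have h1 : Tendsto (fun n => ε / 2 + d * (4 * (1 - fzr n ^ 2) / δ ^ 2)) atTop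
          (𝓝 (ε / 2 + d * (4 * (1 - 1 ^ 2) / δ ^ 2))) := by
        have : Continuous fun x : ℝ => ε / 2 + d * (4 * (1 - x ^ 2) / δ ^ 2) := by fun_prop
        exact (this.tendsto 1).comp fzr_tendsto
      have h2 := h1.eventually_lt_const (show ε / 2 + d * (4 * (1 - 1 ^ 2) / δ ^ 2) < ε by
        norm_num; exact hε)
      obtain ⟨N, hN⟩ := eventually_atTop.1 h2
      refine ⟨N, fun n hn => ?_⟩
      rw [Real.dist_eq]
      exact ((hap n hη).2.2 (ε / 2) (by positivity) δ hδ (fun ζ hζ => by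
        rw [← Real.dist_eq]; exact (hδ' hζ).le)).trans_lt (hN n hn.le)
  calc ∫⁻ ζ, f ζ * liminf (fun n => fzU d μ n ζ) atTop ∂m
      = ∫⁻ ζ, liminf (fun n => f ζ * fzU d μ n ζ) atTop ∂m := by
        refine lintegral_congr fun ζ => ?_
        exact (ENNReal.liminf_const_mul_of_ne_top ENNReal.coe_ne_top).symm
    _ ≤ liminf (fun n => ∫⁻ ζ, f ζ * fzU d μ n ζ ∂m) atTop :=
        lintegral_liminf_le fun n => hfm.mul (fzU_meas μ n)
    _ = ∫⁻ η, f η ∂μ := by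
        simp only [hAU]
        exact hlim.liminf_eq

lemma fz_liminf {d : ℕ} (μ : Measure (Fin d → ℂ)) [IsProbabilityMeasure μ] (hμ : ∀ᵐ η ∂μ, η ∈ polyTorus d)
    (hsing : μ.MutuallySingular (torusLebesgue d)) :
    ∀ᵐ ζ ∂(torusLebesgue d), liminf (fun n => fzU d μ n ζ) atTop = 0 := by
  set g : (Fin d → ℂ) → ENNReal := fun ζ => liminf (fun n => fzU d μ n ζ) atTop with hg
  have hgm : Measurable g := Measurable.liminf (fun n => fzU_meas μ n)
  obtain ⟨S, hS, hμS, hmS⟩ := hsing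
  set m := torusLebesgue d with hm
  have hK : ∀ K : Set (Fin d → ℂ), IsClosed K → μ K = 0 → m ({ζ | g ζ ≠ 0} ∩ K) = 0 := by
    intro K hKc hK0
    have h1 : ∫⁻ ζ in K, g ζ ∂m = 0 := by
      have hpos : ∀ n : ℕ, (0:ℝ) < 1 / ((n:ℝ) + 1) := fun n => by positivity
      have ht := tendsto_lintegral_thickenedIndicator_of_isClosed μ hKc hpos
        tendsto_one_div_add_atTop_nhds_zero_nat
      rw [hK0] at ht
      refine le_antisymm (ge_of_tendsto' ht fun n => ?_) bot_le
      refine le_trans ?_ (fz_weak μ hμ (thickenedIndicator (hpos n) K).continuous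
        (fun x => thickenedIndicator_le_one (hpos n) K x))
      rw [← lintegral_indicator hKc.measurableSet]
      refine lintegral_mono fun ζ => ?_
      by_cases hζ : ζ ∈ K
      · rw [Set.indicator_of_mem hζ, thickenedIndicator_one (hpos n) K hζ]
        simp [hg]
      · rw [Set.indicator_of_notMem hζ]
        exact bot_le
    rw [lintegral_eq_zero_iff hgm] at h1
    have h2 : (m.restrict K) {ζ | g ζ ≠ 0} = 0 := h1
    rwa [Measure.restrict_apply' hKc.measurableSet] at h2
  have hS0 : m ({ζ | g ζ ≠ 0} ∩ S) = 0 := by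
    refine le_antisymm (le_of_forall_pos_le_add fun ε hε => ?_) bot_le
    obtain ⟨K, hKS, hKc, hlt⟩ := hS.exists_isClosed_sdiff_lt (measure_ne_top m S) hε.ne'
    calc m ({ζ | g ζ ≠ 0} ∩ S) ≤ m (({ζ | g ζ ≠ 0} ∩ K) ∪ (S \ K)) := by
          apply measure_mono
          rintro ζ ⟨h1, h2⟩
          by_cases h : ζ ∈ K
          · exact Or.inl ⟨h1, h⟩
          · exact Or.inr ⟨h2, h⟩
      _ ≤ m ({ζ | g ζ ≠ 0} ∩ K) + m (S \ K) := measure_union_le _ _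
      _ ≤ 0 + ε := by
          rw [hK K hKc (measure_mono_null hKS hμS)]
          gcongr
  show m {ζ | g ζ ≠ 0} = 0
  refine measure_mono_null (t := ({ζ | g ζ ≠ 0} ∩ S) ∪ Sᶜ) ?_ (measure_union_null hS0 hmS)
  intro ζ h1
  by_cases h : ζ ∈ S
  · exact Or.inl ⟨h1, h⟩
  · exact Or.inr h

/-- Let `μ` be a pluriharmonic positive Borel probability measure on
`𝕋^d` which is singular with respect to Lebesgue measure on `𝕋^d`. Then any holomorphic
`φ_μ : 𝔻^d → 𝔻` whose Clark-type identity at `α = 1` recovers the Poisson integral of `μ`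
is an inner function: its radial limits exist and have modulus `1` at Lebesgue-a.e.
point of `𝕋^d`. -/
theorem singular_pluriharmonic_gives_inner
    (d : ℕ) (hd : 0 < d) (μ : Measure (Fin d → ℂ)) [IsProbabilityMeasure μ]
    (hμtorus : μ (polyTorus d)ᶜ = 0)
    (H : (Fin d → ℂ) → ℂ)
    (hH : DifferentiableOn ℂ H (polyDisk d))
    (hHre : ∀ z ∈ polyDisk d, (H z).re = ∫ ζ, poissonD d z ζ ∂μ)
    (hsing : μ.MutuallySingular (torusLebesgue d))
    (φ : (Fin d → ℂ) → ℂ)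
    (hφdiff : DifferentiableOn ℂ φ (polyDisk d))
    (hφdisk : ∀ z ∈ polyDisk d, ‖φ z‖ < 1)
    (hφid : ∀ z ∈ polyDisk d,
      (1 - ‖φ z‖ ^ 2) / ‖1 - φ z‖ ^ 2 = ∫ ζ, poissonD d z ζ ∂μ) :
    ∀ᵐ ζ ∂(torusLebesgue d), ∃ L : ℂ, ‖L‖ = 1 ∧ HasRadialLimit d φ ζ L := by
  have hμ : ∀ᵐ η ∂μ, η ∈ polyTorus d := hμtorus
  filter_upwards [fz_exists_lim hφdiff hφdisk, fz_liminf μ hμ hsing] with ζ hlim hU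
  obtain ⟨hζ, L, hL⟩ := hlim
  refine ⟨L, ?_, hL⟩
  have hmem : ∀ n, (fun j => (fzr n : ℂ) * ζ j) ∈ polyDisk d := fun n => fz_scale_mem hζ (by
    rw [Complex.norm_real, Real.norm_of_nonneg (fzr_pos n).le]; exact fzr_lt n)
  have hseq : Tendsto (fun n => φ (fun j => (fzr n : ℂ) * ζ j)) atTop (𝓝 L) := by
    refine hL.comp (tendsto_nhdsWithin_iff.2 ⟨fzr_tendsto, Eventually.of_forall fzr_lt⟩)
  have hL1 : ‖L‖ ≤ 1 := le_of_tendsto' hseq.norm fun n => (hφdisk _ (hmem n)).le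
  by_contra hne
  have hlt : ‖L‖ < 1 := lt_of_le_of_ne hL1 hne
  have h1L : 1 - L ≠ 0 := by
    intro h
    rw [sub_eq_zero] at h
    rw [← h] at hlt
    simp at hlt
  have hpos : 0 < (1 - ‖L‖ ^ 2) / ‖1 - L‖ ^ 2 := by
    have : 0 < 1 - ‖L‖ ^ 2 := by nlinarith [norm_nonneg L]
    have := norm_pos_iff.2 h1L
    positivity
  have ht : Tendsto (fun n => (1 - ‖φ (fun j => (fzr n : ℂ) * ζ j)‖ ^ 2) /
      ‖1 - φ (fun j => (fzr n : ℂ) * ζ j)‖ ^ 2) atTop (𝓝 ((1 - ‖L‖ ^ 2) / ‖1 - L‖ ^ 2)) :=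
    ((hseq.norm.pow 2).const_sub 1).div ((hseq.const_sub 1).norm.pow 2)
      (pow_ne_zero _ (norm_ne_zero_iff.2 h1L))
  have ht' := (ENNReal.continuous_ofReal.tendsto _).comp ht
  have hle : ∀ n, ENNReal.ofReal ((1 - ‖φ (fun j => (fzr n : ℂ) * ζ j)‖ ^ 2) /
      ‖1 - φ (fun j => (fzr n : ℂ) * ζ j)‖ ^ 2) ≤ fzU d μ n ζ := by
    intro n
    rw [hφid _ (hmem n)]
    by_cases hi : Integrable (fun η => poissonD d (fun j => (fzr n : ℂ) * ζ j) η) μ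
    · rw [ofReal_integral_eq_lintegral_ofReal hi]
      · rfl
      · refine Eventually.of_forall fun η => Finset.prod_nonneg fun j _ => div_nonneg ?_ (by positivity)
        have := hmem n j
        nlinarith [norm_nonneg ((fzr n : ℂ) * ζ j)]
    · rw [integral_undef hi]
      simp
  have h3 : ENNReal.ofReal ((1 - ‖L‖ ^ 2) / ‖1 - L‖ ^ 2) ≤ 0 := by
    rw [← hU, ← ht'.liminf_eq]
    exact liminf_le_liminf (Eventually.of_forall hle)
  rw [nonpos_iff_eq_zero, ENNReal.ofReal_eq_zero] at h3
  linarith
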